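/- arXiv:2402.10355 — 4 statements merged into one kernel-verified Lean document; each statement's English description precedes it below -/
import Mathlib

section
/- Let L/K be a finite Galois extension of fields with Galois group G = Gal(L/K), and let n be a positive integer. Then the kernel of the natural group homomorphism K^×/(K^×)^n → L^×/(L^×)^n induced by the inclusion K ⊆ L is isomorphic, as an abelian group, to the first group cohomology group H^1(G, μ_n(L)), where μ_n(L) = {x ∈ L^× : x^n = 1} carries its natural G-action. -/
/-- Two surjective homomorphisms out of the same group with the same kernel have isomorphic
targets. -/
theorem MonoidHom.nonempty_mulEquiv_of_ker_eq {P A B : Type*} [Group P] [Group A] [Group B]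
    (f : P →* A) (g : P →* B) (hf : Function.Surjective f) (hg : Function.Surjective g)
    (h : f.ker = g.ker) : Nonempty (A ≃* B) :=
  ⟨(QuotientGroup.quotientKerEquivOfSurjective f hf).symm.trans
    ((QuotientGroup.quotientMulEquivOfEq h).trans
      (QuotientGroup.quotientKerEquivOfSurjective g hg))⟩

namespace Kummer

section

variable (K L : Type) [Field K] [Field L] [Algebra K L] (n : ℕ)

/-- The action of `Gal(L/K)` on the `n`-th roots of unity of `L`. -/
abbrev rootsOfUnityAction : MulDistribMulAction (L ≃ₐ[K] L) (rootsOfUnity n L) where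
  smul σ x := restrictRootsOfUnity (σ : L ≃ₐ[K] L) n x
  one_smul x := by ext; rfl
  mul_smul σ τ x := by ext; rfl
  smul_mul σ x y := by ext; exact map_mul σ _ _
  smul_one σ := by ext; exact map_one σ

attribute [local instance] rootsOfUnityAction

/-- The inclusion `Kˣ → Lˣ`. -/
abbrev unitsMap : Kˣ →* Lˣ := Units.map (algebraMap K L).toMonoidHom

/-- The inclusion `Kˣ → Lˣ` maps `n`-th powers to `n`-th powers. -/
theorem range_pow_le_comap :
    (powMonoidHom n : Kˣ →* Kˣ).range ≤
      ((powMonoidHom n : Lˣ →* Lˣ).range).comap (unitsMap K L) := by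
  rintro x ⟨y, rfl⟩
  exact ⟨unitsMap K L y, by rw [powMonoidHom_apply, powMonoidHom_apply, map_pow]⟩

/-- The natural map `Kˣ/(Kˣ)ⁿ → Lˣ/(Lˣ)ⁿ`. -/
abbrev powQuotientMap :
    Kˣ ⧸ (powMonoidHom n : Kˣ →* Kˣ).range →* Lˣ ⧸ (powMonoidHom n : Lˣ →* Lˣ).range :=
  QuotientGroup.map _ _ (unitsMap K L) (range_pow_le_comap K L n)

/-- The pairs `(a, β) ∈ Kˣ × Lˣ` with `a = βⁿ`. -/
def pairs : Subgroup (Kˣ × Lˣ) :=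
  ((unitsMap K L).comp (MonoidHom.fst Kˣ Lˣ)).eqLocus
    ((powMonoidHom n).comp (MonoidHom.snd Kˣ Lˣ))

variable {K L n}

theorem coe_smul_rootsOfUnity (σ : L ≃ₐ[K] L) (ζ : rootsOfUnity n L) :
    ((σ • ζ : rootsOfUnity n L) : Lˣ) = σ • (ζ : Lˣ) := by
  ext; rfl

theorem mem_pairs {p : Kˣ × Lˣ} : p ∈ pairs K L n ↔ unitsMap K L p.1 = p.2 ^ n := Iff.rfl

theorem smul_unitsMap (σ : L ≃ₐ[K] L) (a : Kˣ) : σ • unitsMap K L a = unitsMap K L a := by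
  ext; simp

theorem unitsMap_injective : Function.Injective (unitsMap K L) :=
  Units.map_injective (algebraMap K L).injective

theorem exists_unitsMap_eq [FiniteDimensional K L] [IsGalois K L] {β : Lˣ}
    (h : ∀ σ : L ≃ₐ[K] L, σ • β = β) : ∃ b : Kˣ, unitsMap K L b = β := by
  obtain ⟨b, hb⟩ := (IsGalois.mem_range_algebraMap_iff_fixed (F := K) (β : L)).2
    fun σ => congrArg Units.val (h σ)
  have hb0 : b ≠ 0 := by
    rintro rfl
    exact β.ne_zero (by rw [← hb, map_zero])
  exact ⟨Units.mk0 b hb0, Units.ext hb⟩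

theorem smul_div_mem_rootsOfUnity (p : pairs K L n) (σ : L ≃ₐ[K] L) :
    σ • p.1.2 / p.1.2 ∈ rootsOfUnity n L := by
  rw [mem_rootsOfUnity, div_pow, ← smul_pow', ← mem_pairs.1 p.2, smul_unitsMap, div_self']

variable (K L n) in
/-- The homomorphism sending `(a, β)` with `a = βⁿ` to the class of `a`. -/
def toKer : pairs K L n →* (powQuotientMap K L n).ker :=
  ((QuotientGroup.mk' _).comp ((MonoidHom.fst Kˣ Lˣ).comp (pairs K L n).subtype)).codRestrict _
    fun p => (QuotientGroup.eq_one_iff _).2 ⟨p.1.2, (mem_pairs.1 p.2).symm⟩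

theorem toKer_surjective : Function.Surjective (toKer K L n) := by
  rintro ⟨a, ha⟩
  obtain ⟨a, rfl⟩ := QuotientGroup.mk_surjective a
  obtain ⟨β, hβ⟩ := (QuotientGroup.eq_one_iff _).1 ha
  exact ⟨⟨(a, β), hβ.symm⟩, rfl⟩

theorem toKer_eq_one_iff (p : pairs K L n) : toKer K L n p = 1 ↔ ∃ b : Kˣ, b ^ n = p.1.1 :=
  Subtype.ext_iff.trans (QuotientGroup.eq_one_iff _)

/-- The cocycle `σ ↦ σ β / β` with values in the `n`-th roots of unity. -/
def cocycle (p : pairs K L n) (σ : L ≃ₐ[K] L) : rootsOfUnity n L :=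
  ⟨σ • p.1.2 / p.1.2, smul_div_mem_rootsOfUnity p σ⟩

theorem isMulCocycle₁_cocycle (p : pairs K L n) : groupCohomology.IsMulCocycle₁ (cocycle p) := by
  intro σ τ
  apply Subtype.ext
  rw [Subgroup.coe_mul, coe_smul_rootsOfUnity]
  simp only [cocycle]
  rw [smul_div', mul_smul, div_mul_div_cancel]

theorem isMulCoboundary₁_cocycle_iff [FiniteDimensional K L] [IsGalois K L] (p : pairs K L n) :
    groupCohomology.IsMulCoboundary₁ (cocycle p) ↔ ∃ b : Kˣ, b ^ n = p.1.1 := by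
  constructor
  · rintro ⟨ζ, hζ⟩
    obtain ⟨b, hb⟩ := exists_unitsMap_eq (K := K) (β := p.1.2 / (ζ : Lˣ)) fun σ => by
      have h := congrArg Subtype.val (hζ σ)
      rw [Subgroup.coe_div, coe_smul_rootsOfUnity] at h
      simp only [cocycle] at h
      rw [smul_div', div_eq_div_iff_mul_eq_mul, mul_comm p.1.2, ← div_eq_div_iff_mul_eq_mul, h]
    refine ⟨b, unitsMap_injective (K := K) (L := L) ?_⟩
    rw [map_pow, hb, div_pow, (mem_rootsOfUnity _ _).1 ζ.2, div_one, mem_pairs.1 p.2]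
  · rintro ⟨b, hb⟩
    have hζ : p.1.2 / unitsMap K L b ∈ rootsOfUnity n L := by
      rw [mem_rootsOfUnity, div_pow, ← map_pow, hb, mem_pairs.1 p.2, div_self']
    refine ⟨⟨_, hζ⟩, fun σ => Subtype.ext ?_⟩
    rw [Subgroup.coe_div, coe_smul_rootsOfUnity]
    simp only [cocycle]
    rw [smul_div', smul_unitsMap, div_div_div_cancel_right]

theorem exists_cocycle_eq [FiniteDimensional K L] [IsGalois K L]
    {f : (L ≃ₐ[K] L) → rootsOfUnity n L}
    (hf : groupCohomology.IsMulCocycle₁ f) : ∃ p : pairs K L n, cocycle p = f := by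
  obtain ⟨β, hβ⟩ := groupCohomology.isMulCoboundary₁_of_isMulCocycle₁_of_aut_to_units
    (fun σ => (f σ : Lˣ)) fun σ τ => by
      simp only [hf σ τ, Subgroup.coe_mul, coe_smul_rootsOfUnity]
  obtain ⟨a, ha⟩ := exists_unitsMap_eq (K := K) (β := β ^ n) fun σ => by
    rw [smul_pow', ← div_eq_one, ← div_pow, hβ]
    exact (mem_rootsOfUnity _ _).1 (f σ).2
  exact ⟨⟨(a, β), ha⟩, funext fun σ => Subtype.ext (hβ σ)⟩

open groupCohomology in
variable (K L n) in
/-- The homomorphism sending `(a, β)` with `a = βⁿ` to the class of the cocycle `σ ↦ σ β / β`. -/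
noncomputable def toH1 : pairs K L n →*
    Multiplicative (H1 (Rep.ofMulDistribMulAction (L ≃ₐ[K] L) (rootsOfUnity n L))) :=
  MonoidHom.mk' (fun p => .ofAdd (H1π _ (cocyclesOfIsMulCocycle₁ (isMulCocycle₁_cocycle p))))
    fun p q => by
      rw [← ofAdd_add, ← map_add]
      congr 2
      refine cocycles₁_ext fun σ => congrArg Additive.ofMul (Subtype.ext ?_)
      change σ • (p.1.2 * q.1.2) / (p.1.2 * q.1.2) = σ • p.1.2 / p.1.2 * (σ • q.1.2 / q.1.2)
      rw [smul_mul', mul_div_mul_comm]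

theorem toH1_surjective [FiniteDimensional K L] [IsGalois K L] :
    Function.Surjective (toH1 K L n) := by
  intro x
  refine groupCohomology.H1_induction_on (C := fun x => ∃ p, toH1 K L n p = .ofAdd x) x.toAdd
    fun f => ?_
  obtain ⟨p, hp⟩ := exists_cocycle_eq (groupCohomology.isMulCocycle₁_of_mem_cocycles₁ _ f.2)
  refine ⟨p, congrArg (fun y => Multiplicative.ofAdd (groupCohomology.H1π _ y)) ?_⟩
  exact Subtype.ext hp

theorem toH1_eq_one_iff [FiniteDimensional K L] [IsGalois K L] (p : pairs K L n) :
    toH1 K L n p = 1 ↔ ∃ b : Kˣ, b ^ n = p.1.1 := by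
  rw [← isMulCoboundary₁_cocycle_iff]
  refine (groupCohomology.H1π_eq_zero_iff _).trans
    ⟨groupCohomology.isMulCoboundary₁_of_mem_coboundaries₁ _, fun h => ?_⟩
  exact (groupCohomology.coboundariesOfIsMulCoboundary₁ h).2

end

end Kummer

/-- For a finite Galois extension `L/K` with `G = Gal(L/K)` and `n ≥ 1`, the kernel of
the natural map `K^×/(K^×)ⁿ → L^×/(L^×)ⁿ` is isomorphic, as an abelian group, to the
first group cohomology group `H¹(G, μ_n(L))`. -/
theorem ker_pow_quotient_map_iso_H1_rootsOfUnity (K L : Type) [Field K] [Field L]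
    [Algebra K L] [FiniteDimensional K L] [IsGalois K L] (n : ℕ) (hn : 0 < n) :
    letI : MulDistribMulAction (L ≃ₐ[K] L) (rootsOfUnity n L) :=
      { smul := fun σ x => restrictRootsOfUnity (σ : L ≃ₐ[K] L) n x
        one_smul := fun x => by ext; rfl
        mul_smul := fun σ τ x => by ext; rfl
        smul_mul := fun σ x y => by ext; exact map_mul σ _ _
        smul_one := fun σ => by ext; exact map_one σ }
    Nonempty
      (Additive
        (MonoidHom.ker
          (QuotientGroup.map ((powMonoidHom n : Kˣ →* Kˣ).range)
            ((powMonoidHom n : Lˣ →* Lˣ).range)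
            (Units.map (algebraMap K L).toMonoidHom)
            (by
              rintro x ⟨y, rfl⟩
              exact ⟨Units.map (algebraMap K L).toMonoidHom y, by
                rw [powMonoidHom_apply, powMonoidHom_apply, map_pow]⟩))) ≃+
        groupCohomology.H1
          (Rep.ofMulDistribMulAction (L ≃ₐ[K] L) (rootsOfUnity n L))) := by
  obtain ⟨e⟩ := MonoidHom.nonempty_mulEquiv_of_ker_eq (Kummer.toKer K L n) (Kummer.toH1 K L n)
    Kummer.toKer_surjective Kummer.toH1_surjective <| by
      ext p
      exact (Kummer.toKer_eq_one_iff p).trans (Kummer.toH1_eq_one_iff p).symm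
  exact ⟨MulEquiv.toAdditiveLeft e⟩
end

section
/- Let ζ₃ denote a primitive third root of unity in the cyclotomic field ℚ(ζ₃). For all rational numbers c and d, the element (c + d·ζ₃)³ lies in the image of ℚ in ℚ(ζ₃) if and only if c·d = 0 or c = d. -/
theorem IsPrimitiveRoot.sq_add_self_add_one {R : Type*} [CommRing R] [IsDomain R] {ζ : R}
    (hζ : IsPrimitiveRoot ζ 3) : ζ ^ 2 + ζ + 1 = 0 := by
  have h := hζ.geom_sum_eq_zero (by norm_num)
  simp only [Finset.sum_range_succ, Finset.sum_range_zero] at h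
  linear_combination h

theorem IsPrimitiveRoot.algebraMap_ne_of_three {K : Type*} [Field K] [Algebra ℚ K] {ζ : K}
    (hζ : IsPrimitiveRoot ζ 3) (r : ℚ) : algebraMap ℚ K r ≠ ζ := by
  rintro rfl
  have h : r ^ 2 + r + 1 = 0 :=
    (algebraMap ℚ K).injective (by simpa only [map_add, map_pow, map_one, map_zero] using
      hζ.sq_add_self_add_one)
  nlinarith [sq_nonneg (2 * r + 1)]

/-- Let `ζ₃` be a primitive third root of unity in the cyclotomic field `ℚ(ζ₃)`.
For all rationals `c, d`, the element `(c + d·ζ₃)³` lies in the image of `ℚ`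
iff `c·d = 0` or `c = d`. -/
theorem cube_mem_rat_iff (ζ : CyclotomicField 3 ℚ) (hζ : IsPrimitiveRoot ζ 3)
    (c d : ℚ) :
    (∃ q : ℚ, (algebraMap ℚ (CyclotomicField 3 ℚ) c +
        algebraMap ℚ (CyclotomicField 3 ℚ) d * ζ) ^ 3 =
        algebraMap ℚ (CyclotomicField 3 ℚ) q) ↔ c * d = 0 ∨ c = d := by
  have hcube : (algebraMap ℚ (CyclotomicField 3 ℚ) c +
      algebraMap ℚ (CyclotomicField 3 ℚ) d * ζ) ^ 3 =
      algebraMap ℚ (CyclotomicField 3 ℚ) (c ^ 3 + d ^ 3 - 3 * c * d ^ 2) +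
        algebraMap ℚ (CyclotomicField 3 ℚ) (3 * (c * d) * (c - d)) * ζ := by
    simp only [map_add, map_sub, map_mul, map_pow, map_ofNat]
    linear_combination (3 * algebraMap ℚ (CyclotomicField 3 ℚ) c *
      algebraMap ℚ (CyclotomicField 3 ℚ) d ^ 2 +
      algebraMap ℚ (CyclotomicField 3 ℚ) d ^ 3 * (ζ - 1)) * hζ.sq_add_self_add_one
  rw [hcube]
  constructor
  · rintro ⟨q, hq⟩
    by_contra! hne
    have hcoeff : 3 * (c * d) * (c - d) ≠ 0 :=
      mul_ne_zero (mul_ne_zero three_ne_zero hne.1) (sub_ne_zero.mpr hne.2)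
    refine hζ.algebraMap_ne_of_three
      ((q - (c ^ 3 + d ^ 3 - 3 * c * d ^ 2)) / (3 * (c * d) * (c - d))) ?_
    rw [map_div₀, map_sub, ← hq, add_sub_cancel_left]
    exact mul_div_cancel_left₀ ζ ((map_ne_zero _).mpr hcoeff)
  · intro h
    have hcoeff : 3 * (c * d) * (c - d) = 0 := by
      rcases h with h | h <;> simp [h]
    exact ⟨c ^ 3 + d ^ 3 - 3 * c * d ^ 2, by rw [hcoeff, map_zero, zero_mul, add_zero]⟩
end

section
/- Let n ≥ 2 be an integer and let a be a squarefree integer with |a| ≥ 2 that is coprime to n. Then the polynomial X^n − a is irreducible over ℚ, so L = ℚ[X]/(X^n − a) is a number field of degree n over ℚ. Moreover, for every prime p dividing a, the exact power of p dividing the discriminant of L is p^{n−1} (i.e., p^{n−1} divides disc(L) and p^n does not), and for every prime p dividing neither a nor n, p does not divide the discriminant of L. -/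
open Polynomial

/-- If the family `c` lies in the `R`-span of the family `b`, then `discr c` is the square of an
element of `R` times `discr b`. -/
theorem Algebra.exists_discr_eq_sq_mul_of_mem_span {R A B ι : Type*} [CommRing R] [CommRing A]
    [CommRing B] [Algebra R A] [Algebra R B] [Algebra A B] [IsScalarTower R A B] [Fintype ι]
    [DecidableEq ι] (b c : ι → B) (h : ∀ i, c i ∈ Submodule.span R (Set.range b)) :
    ∃ r : R, Algebra.discr A c = algebraMap R A r ^ 2 * Algebra.discr A b := by
  choose P hP using fun i ↦ (Submodule.mem_span_range_iff_exists_fun R).1 (h i)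
  refine ⟨(Matrix.of P).det, ?_⟩
  rw [RingHom.map_det, ← Algebra.discr_of_matrix_mulVec]
  congr 1
  ext i
  simp [Matrix.mulVec, dotProduct, ← hP i, Algebra.smul_def, ← IsScalarTower.algebraMap_apply]

theorem PowerBasis.mem_span_int_of_mem_adjoin {K : Type*} [Field K] [NumberField K]
    (B : PowerBasis ℚ K) (hB : IsIntegral ℤ B.gen) {z : K}
    (hz : z ∈ Algebra.adjoin ℤ {B.gen}) : z ∈ Submodule.span ℤ (Set.range B.basis) := by
  rw [Algebra.adjoin_singleton_eq_range_aeval] at hz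
  obtain ⟨f, rfl⟩ := hz
  have h := hB.mem_span_pow (y := aeval B.gen f) ⟨f, rfl⟩
  rwa [B.coe_basis, ← B.natDegree_minpoly, minpoly.isIntegrallyClosed_eq_field_fractions' ℚ hB,
    (minpoly.monic hB).natDegree_map]

theorem NumberField.exists_discr_powerBasis_eq {K : Type*} [Field K] [NumberField K]
    (B : PowerBasis ℚ K) (hB : IsIntegral ℤ B.gen) :
    ∃ m : ℤ, Algebra.discr ℚ B.basis = m ^ 2 * NumberField.discr K := by
  let e := (NumberField.integralBasis K).indexEquiv B.basis
  rw [NumberField.coe_discr, ← Algebra.discr_reindex ℚ _ e]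
  refine Algebra.exists_discr_eq_sq_mul_of_mem_span (R := ℤ) _ _ fun i ↦ ?_
  rw [e.symm.surjective.range_comp, NumberField.mem_span_integralBasis, B.basis_eq_pow]
  exact ⟨⟨_, hB.pow _⟩, rfl⟩

/-- If `u` times every integral element lies in `ℤ[B.gen]`, then `u ^ (2 * B.dim) * discr K` is
a square times the discriminant of `B`. -/
theorem NumberField.exists_pow_mul_discr_eq {K : Type*} [Field K] [NumberField K]
    (B : PowerBasis ℚ K) (hB : IsIntegral ℤ B.gen) (u : ℤ)
    (hu : ∀ z : K, IsIntegral ℤ z → u • z ∈ Algebra.adjoin ℤ {B.gen}) :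
    ∃ q : ℤ, (u ^ B.dim) ^ 2 * (NumberField.discr K : ℚ) = q ^ 2 * Algebra.discr ℚ B.basis := by
  let e := (NumberField.integralBasis K).indexEquiv B.basis
  have key : Algebra.discr ℚ (u • (NumberField.integralBasis K ∘ e.symm)) =
      (u ^ B.dim) ^ 2 * (NumberField.discr K : ℚ) := by
    have := Algebra.discr_of_matrix_mulVec (NumberField.integralBasis K ∘ e.symm)
      (Matrix.diagonal fun _ ↦ (u : ℚ))
    rw [NumberField.coe_discr, ← Algebra.discr_reindex ℚ _ e]
    simp only [Matrix.det_diagonal, Finset.prod_const, Finset.card_univ, Fintype.card_fin] at this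
    rw [← this]
    congr 1
    ext i
    simp [Matrix.diagonal_map, Matrix.mulVec_diagonal]
  rw [← key]
  refine Algebra.exists_discr_eq_sq_mul_of_mem_span (R := ℤ) _ _ fun i ↦ ?_
  refine B.mem_span_int_of_mem_adjoin hB (hu _ ?_)
  simpa using NumberField.RingOfIntegers.isIntegral_coe _

theorem Polynomial.isEisensteinAt_X_pow_sub_C {n : ℕ} (hn : n ≠ 0) {a p : ℤ} (hsf : Squarefree a)
    (hp : Prime p) (hpa : p ∣ a) :
    (X ^ n - C a : ℤ[X]).IsEisensteinAt (Ideal.span {p}) := by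
  refine (monic_X_pow_sub_C a hn).isEisensteinAt_of_mem_of_notMem ?_ ?_ ?_
  · rw [Ne, Ideal.span_singleton_eq_top]
    exact hp.not_isUnit
  · intro i hi
    rw [natDegree_X_pow_sub_C] at hi
    rw [Ideal.mem_span_singleton]
    rcases eq_or_ne i 0 with rfl | h
    · simpa [coeff_X_pow, hn.symm] using hpa
    · simp [coeff_X_pow, hi.ne, coeff_C_of_ne_zero h, -map_intCast, -eq_intCast]
  · rw [Ideal.span_singleton_pow, Ideal.mem_span_singleton]
    intro h
    refine hp.not_isUnit (hsf p ?_)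
    simpa [coeff_X_pow, hn.symm, sq] using h

theorem discr_powerBasis_of_minpoly_eq_X_pow_sub_C {K L : Type*} [Field K] [Field L] [Algebra K L]
    [Algebra.IsSeparable K L] (B : PowerBasis K L) {n : ℕ} (hn : n ≠ 0) {a : K}
    (h : minpoly K B.gen = X ^ n - C a) :
    ∃ e : ℕ, Algebra.discr K B.basis = (-1) ^ e * (n ^ n * a ^ (n - 1)) := by
  have hfin := B.finite
  have hdim : B.dim = n := by rw [← B.natDegree_minpoly, h, natDegree_X_pow_sub_C]
  have hrank : Module.finrank K L = n := by rw [B.finrank, hdim]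
  have hnorm : Algebra.norm K B.gen = (-1) ^ (n + 1) * a := by
    rw [Algebra.PowerBasis.norm_gen_eq_coeff_zero_minpoly, hdim, h]
    simp [coeff_X_pow, hn.symm, pow_succ]
  refine ⟨n * (n - 1) / 2 + (n + 1) * (n - 1), ?_⟩
  have hder : aeval B.gen (derivative (X ^ n - C a)) = algebraMap K L n * B.gen ^ (n - 1) := by
    simp [derivative_X_pow]
  rw [Algebra.discr_powerBasis_eq_norm, h, hder, map_mul, map_pow, Algebra.norm_algebraMap, hrank,
    hnorm]
  ring

theorem NumberField.discr_of_minpoly_eq_X_pow_sub_C {K : Type*} [Field K] [NumberField K]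
    [alg : Algebra ℚ K] (B : PowerBasis ℚ K) {n : ℕ} (hn0 : n ≠ 0) {a : ℤ} (hsf : Squarefree a)
    (hcop : IsCoprime a (n : ℤ)) (hminQ : minpoly ℚ B.gen = X ^ n - C (a : ℚ)) :
    (∀ p : ℕ, p.Prime → (p : ℤ) ∣ a →
      (p : ℤ) ^ (n - 1) ∣ NumberField.discr K ∧ ¬ (p : ℤ) ^ n ∣ NumberField.discr K) ∧
    (∀ p : ℕ, p.Prime → ¬ (p : ℤ) ∣ a → ¬ (p : ℤ) ∣ (n : ℤ) → ¬ (p : ℤ) ∣ NumberField.discr K) := by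
  obtain rfl : alg = DivisionRing.toRatAlgebra := Subsingleton.elim _ _
  have hmap : (X ^ n - C a : ℤ[X]).map (algebraMap ℤ ℚ) = X ^ n - C (a : ℚ) := by simp
  have hB : IsIntegral ℤ B.gen := by
    refine ⟨X ^ n - C a, monic_X_pow_sub_C a hn0, ?_⟩
    rw [← aeval_def, ← aeval_map_algebraMap ℚ, hmap, ← hminQ, minpoly.aeval]
  have hminZ : minpoly ℤ B.gen = X ^ n - C a := by
    apply map_injective (algebraMap ℤ ℚ) (algebraMap ℤ ℚ).injective_int
    rw [← minpoly.isIntegrallyClosed_eq_field_fractions' ℚ hB, hminQ, hmap]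
  obtain ⟨e, he⟩ := discr_powerBasis_of_minpoly_eq_X_pow_sub_C B hn0 hminQ
  obtain ⟨m, hm⟩ := NumberField.exists_discr_powerBasis_eq B hB
  have hdvd : NumberField.discr K ∣
      (n : ℤ) ^ n * a ^ (n - 1) := by
    have : (-1) ^ e * ((n : ℤ) ^ n * a ^ (n - 1)) = m ^ 2 * NumberField.discr K := by
      exact_mod_cast he.symm.trans hm
    rw [← ((isUnit_one.neg : IsUnit (-1 : ℤ)).pow e).dvd_mul_left, this]
    exact dvd_mul_left _ _
  refine ⟨fun p hp hpa ↦ ?_, fun p hp hpa hpn hpd ↦ ?_⟩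
  · have hp' : Prime (p : ℤ) := Nat.prime_iff_prime_int.1 hp
    obtain ⟨c, rfl⟩ := hpa
    have hpc : ¬ (p : ℤ) ∣ c := fun ⟨d, hd⟩ ↦
      hp'.not_isUnit (hsf p ⟨d, by rw [hd, mul_assoc]⟩)
    have hpn : ¬ (p : ℤ) ∣ n := fun h ↦
      hp'.not_isUnit (hcop.isUnit_of_dvd' (dvd_mul_right _ _) h)
    have hpu : ¬ (p : ℤ) ∣ n ^ n * c ^ (n - 1) := fun h ↦
      (hp'.dvd_or_dvd h).elim (fun h ↦ hpn (hp'.dvd_of_dvd_pow h))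
        fun h ↦ hpc (hp'.dvd_of_dvd_pow h)
    have hfac : (n : ℤ) ^ n * (p * c) ^ (n - 1) = p ^ (n - 1) * (n ^ n * c ^ (n - 1)) := by ring
    constructor
    · set u : ℤ := (-1) ^ e * (n ^ n * c ^ (n - 1)) with hu
      have hpu' : ¬ (p : ℤ) ∣ u := by
        rwa [hu, ((isUnit_one.neg : IsUnit (-1 : ℤ)).pow e).dvd_mul_left]
      have hdisc : Algebra.discr ℚ B.basis = ((p ^ (n - 1) * u : ℤ) : ℚ) := by
        rw [he, hu]; push_cast; ring
      obtain ⟨q, hq⟩ := NumberField.exists_pow_mul_discr_eq B hB u fun z hz ↦ by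
        refine mem_adjoin_of_smul_prime_pow_smul_of_minpoly_isEisensteinAt (K := ℚ) hp' hB
          (n := n - 1) (hz.smul u) ?_ (hminZ ▸ isEisensteinAt_X_pow_sub_C hn0 hsf hp' ⟨c, rfl⟩)
        have := Algebra.discr_mul_isIntegral_mem_adjoin ℚ hB hz
        rwa [hdisc, Int.cast_smul_eq_zsmul, mul_smul] at this
      rw [hdisc] at hq
      have hq' : (u ^ B.dim) ^ 2 * NumberField.discr K = q ^ 2 * (p ^ (n - 1) * u) := by
        exact_mod_cast hq
      refine hp'.pow_dvd_of_dvd_mul_left (n - 1) (a := (u ^ B.dim) ^ 2) ?_ ?_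
      · exact fun h ↦ hpu' (hp'.dvd_of_dvd_pow (hp'.dvd_of_dvd_pow h))
      · exact hq' ▸ (dvd_mul_right _ _).mul_left _
    · intro h
      have hd := h.trans hdvd
      rw [hfac] at hd
      have hpow : (p : ℤ) ^ n = p ^ (n - 1) * p := by
        rw [← pow_succ, Nat.sub_add_cancel (Nat.one_le_iff_ne_zero.2 hn0)]
      rw [hpow, mul_dvd_mul_iff_left (pow_ne_zero _ hp'.ne_zero)] at hd
      exact hpu hd
  · have hp' : Prime (p : ℤ) := Nat.prime_iff_prime_int.1 hp
    exact (hp'.dvd_or_dvd (hpd.trans hdvd)).elim (fun h ↦ hpn (hp'.dvd_of_dvd_pow h))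
      fun h ↦ hpa (hp'.dvd_of_dvd_pow h)

/-- For `n ≥ 2` and a squarefree integer `a` with `|a| ≥ 2` coprime to `n`, the
polynomial `Xⁿ − a` is irreducible over `ℚ`, so `L = ℚ[X]/(Xⁿ − a)` is a number field
of degree `n`; moreover for each prime `p ∣ a` the exact power of `p` dividing
`disc(L)` is `p^{n−1}`, and primes dividing neither `a` nor `n` do not divide `disc(L)`. -/
theorem discr_of_pure_field (n : ℕ) (hn : 2 ≤ n) (a : ℤ) (hsf : Squarefree a)
    (ha : 2 ≤ |a|) (hcop : IsCoprime a (n : ℤ)) :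
    ∃ hirr : Irreducible ((X : ℚ[X]) ^ n - C (a : ℚ)),
      haveI : Fact (Irreducible ((X : ℚ[X]) ^ n - C (a : ℚ))) := ⟨hirr⟩
      ∃ _ : NumberField (AdjoinRoot ((X : ℚ[X]) ^ n - C (a : ℚ))),
        Module.finrank ℚ (AdjoinRoot ((X : ℚ[X]) ^ n - C (a : ℚ))) = n ∧
        (∀ p : ℕ, p.Prime → (p : ℤ) ∣ a →
          (p : ℤ) ^ (n - 1) ∣ NumberField.discr (AdjoinRoot ((X : ℚ[X]) ^ n - C (a : ℚ))) ∧
          ¬ (p : ℤ) ^ n ∣ NumberField.discr (AdjoinRoot ((X : ℚ[X]) ^ n - C (a : ℚ)))) ∧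
        (∀ p : ℕ, p.Prime → ¬ (p : ℤ) ∣ a → ¬ (p : ℤ) ∣ (n : ℤ) →
          ¬ (p : ℤ) ∣ NumberField.discr (AdjoinRoot ((X : ℚ[X]) ^ n - C (a : ℚ)))) := by
  have hn0 : n ≠ 0 := by lia
  have hmonic : (X ^ n - C a : ℤ[X]).Monic := monic_X_pow_sub_C a hn0
  have hmap : (X ^ n - C a : ℤ[X]).map (algebraMap ℤ ℚ) = X ^ n - C (a : ℚ) := by simp
  have hirr : Irreducible ((X : ℚ[X]) ^ n - C (a : ℚ)) := by
    obtain ⟨p, hp, hpa⟩ := Int.exists_prime_and_dvd (n := a) (by rw [Int.abs_eq_natAbs] at ha; lia)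
    rw [← hmap, ← hmonic.irreducible_iff_irreducible_map_fraction_map]
    exact (isEisensteinAt_X_pow_sub_C hn0 hsf hp hpa).irreducible
      ((Ideal.span_singleton_prime hp.ne_zero).2 hp) hmonic.isPrimitive
      (by rw [natDegree_X_pow_sub_C]; lia)
  refine ⟨hirr, ?_⟩
  have : Fact (Irreducible ((X : ℚ[X]) ^ n - C (a : ℚ))) := ⟨hirr⟩
  let B := AdjoinRoot.powerBasis hirr.ne_zero
  have hmin : minpoly ℚ B.gen = X ^ n - C (a : ℚ) :=
    AdjoinRoot.minpoly_powerBasis_gen_of_monic (monic_X_pow_sub_C _ hn0)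
  have hK : NumberField (AdjoinRoot ((X : ℚ[X]) ^ n - C (a : ℚ))) :=
    { to_charZero := charZero_of_injective_algebraMap (algebraMap ℚ _).injective
      to_finiteDimensional := by convert B.finite }
  exact ⟨hK, B.finrank.trans natDegree_X_pow_sub_C,
    NumberField.discr_of_minpoly_eq_X_pow_sub_C B hn0 hsf hcop hmin⟩
end

section
/- Let n ≥ 2 be an integer. There exists a constant C, depending only on n, such that for every squarefree integer a with |a| ≥ 2 coprime to n (so that L_a = ℚ[X]/(X^n − a) is a number field) and for every prime p dividing n, the p-adic valuation of the discriminant of L_a is at most C. -/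
open Polynomial

/-- The discriminant of an integral `ℚ`-basis of a number field is a square integer multiple of the
discriminant of the field. -/
theorem NumberField.exists_discr_eq_sq_mul_discr {K ι : Type*} [Field K] [NumberField K]
    [Fintype ι] [DecidableEq ι] (b : Module.Basis ι ℚ K) (hb : ∀ i, IsIntegral ℤ (b i)) :
    ∃ r : ℤ, Algebra.discr ℚ b = ((r ^ 2 * NumberField.discr K : ℤ) : ℚ) := by
  let e := (integralBasis K).indexEquiv b
  let c := (RingOfIntegers.basis K).reindex e
  let c' := (integralBasis K).reindex e
  have hint : IsIntegral ℤ (c'.toMatrix b).det := by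
    refine IsIntegral.det fun i j => ?_
    have h := integralBasis_repr_apply K ⟨b j, hb j⟩ (e.symm i)
    rw [show c'.toMatrix b i j = _ from h]
    exact isIntegral_algebraMap
  obtain ⟨r, hr⟩ := IsIntegrallyClosed.isIntegral_iff.1 hint
  refine ⟨r, ?_⟩
  rw [← c'.toMatrix_map_vecMul b, Algebra.discr_of_matrix_vecMul, ← hr, Module.Basis.coe_reindex,
    Algebra.discr_reindex, ← coe_discr]
  simp

/-- The discriminant of the power basis generated by a root of `Xⁿ - a`, up to sign. -/
theorem PowerBasis.abs_discr_of_minpoly_eq_X_pow_sub_C {F K : Type*} [Field F] [LinearOrder F]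
    [IsStrictOrderedRing F] [Field K] [Algebra F K] [FiniteDimensional F K]
    (B : PowerBasis F K) {n : ℕ} (hn : n ≠ 0) {a : F} (hB : minpoly F B.gen = X ^ n - C a) :
    |Algebra.discr F B.basis| = (n : F) ^ n * |a| ^ (n - 1) := by
  have hdim : Module.finrank F K = n := by
    rw [B.finrank, ← B.natDegree_minpoly, hB, natDegree_X_pow_sub_C]
  have hnorm : |Algebra.norm F B.gen| = |a| := by
    rw [Algebra.PowerBasis.norm_gen_eq_coeff_zero_minpoly, hB]
    simp [abs_mul, hn.symm]
  have haeval : aeval B.gen (derivative (minpoly F B.gen)) =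
      algebraMap F K n * B.gen ^ (n - 1) := by
    simp [hB, derivative_X_pow]
  rw [Algebra.discr_powerBasis_eq_norm, haeval, map_mul, map_pow, Algebra.norm_algebraMap, hdim]
  simp [abs_mul, abs_pow, hnorm]

theorem Polynomial.irreducible_X_pow_sub_C_of_squarefree {n : ℕ} (hn : n ≠ 0) {a : ℤ}
    (ha : Squarefree a) (ha' : ¬ IsUnit a) :
    Irreducible ((X : ℚ[X]) ^ n - C (a : ℚ)) := by
  obtain ⟨q, hq, hqa⟩ := WfDvdMonoid.exists_irreducible_factor ha' ha.ne_zero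
  have hq' : Prime q := hq.prime
  have hmonic : (X ^ n - C a : ℤ[X]).Monic := monic_X_pow_sub_C a hn
  have hdeg : (X ^ n - C a : ℤ[X]).natDegree = n := natDegree_X_pow_sub_C
  have heis : (X ^ n - C a : ℤ[X]).IsEisensteinAt (Ideal.span {q}) := by
    refine ⟨?_, fun {i} hi => ?_, ?_⟩
    · rw [hmonic.leadingCoeff, Ideal.mem_span_singleton]
      exact fun h => hq.not_isUnit (isUnit_of_dvd_one h)
    · rw [hdeg] at hi
      rw [Ideal.mem_span_singleton, coeff_sub, coeff_X_pow, if_neg hi.ne, coeff_C]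
      split_ifs <;> simp [hqa]
    · rw [Ideal.span_singleton_pow, Ideal.mem_span_singleton]
      simp only [coeff_sub, coeff_X_pow, hn.symm, if_false, coeff_C_zero, zero_sub, dvd_neg, sq]
      exact fun h => hq.not_isUnit (ha q h)
  have hirr := heis.irreducible ((Ideal.span_singleton_prime hq'.ne_zero).2 hq') hmonic.isPrimitive
    (by omega)
  simpa using (hmonic.irreducible_iff_irreducible_map_fraction_map (K := ℚ)).1 hirr

/-- The discriminant of a number field generated by a root of `Xⁿ - a` divides `nⁿ aⁿ⁻¹`. -/
theorem NumberField.natAbs_discr_dvd_of_minpoly_eq_X_pow_sub_C {K : Type*} [Field K]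
    [NumberField K] (B : PowerBasis ℚ K) {n : ℕ} (hn : n ≠ 0) {a : ℤ}
    (hB : minpoly ℚ B.gen = X ^ n - C (a : ℚ)) :
    (NumberField.discr K).natAbs ∣ n ^ n * a.natAbs ^ (n - 1) := by
  have hgen : IsIntegral ℤ B.gen := by
    refine ⟨X ^ n - C a, monic_X_pow_sub_C a hn, ?_⟩
    have h := minpoly.aeval ℚ B.gen
    rw [hB] at h
    rw [eval₂_sub, eval₂_X_pow, eval₂_C]
    simpa using h
  obtain ⟨r, hr⟩ := exists_discr_eq_sq_mul_discr B.basis fun i => by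
    rw [B.basis_eq_pow]
    exact hgen.pow _
  have h := B.abs_discr_of_minpoly_eq_X_pow_sub_C hn hB
  rw [hr] at h
  have h' : |r ^ 2 * discr K| = (n : ℤ) ^ n * |a| ^ (n - 1) := by exact_mod_cast h
  have h'' : (r ^ 2 * discr K).natAbs = n ^ n * a.natAbs ^ (n - 1) := by
    zify
    exact h'
  rw [← h'', Int.natAbs_mul]
  exact dvd_mul_left _ _

/-- For `n ≥ 2` there is a constant `C` depending only on `n` such that for every
squarefree integer `a` with `|a| ≥ 2` coprime to `n` and every prime `p ∣ n`, the
`p`-adic valuation of the discriminant of `L_a = ℚ[X]/(Xⁿ − a)` is at most `C`. -/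
theorem discr_valuation_bounded_at_primes_dividing_n (n : ℕ) (hn : 2 ≤ n) :
    ∃ C : ℕ, ∀ a : ℤ, Squarefree a → 2 ≤ |a| → IsCoprime a (n : ℤ) →
      ∃ hirr : Irreducible ((X : ℚ[X]) ^ n - Polynomial.C (a : ℚ)),
        haveI : Fact (Irreducible ((X : ℚ[X]) ^ n - Polynomial.C (a : ℚ))) := ⟨hirr⟩
        ∃ _ : NumberField (AdjoinRoot ((X : ℚ[X]) ^ n - Polynomial.C (a : ℚ))),
          ∀ p : ℕ, p.Prime → p ∣ n →
            padicValInt p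
              (NumberField.discr (AdjoinRoot ((X : ℚ[X]) ^ n - Polynomial.C (a : ℚ)))) ≤ C := by
  refine ⟨n ^ n, fun a ha ha2 hcop => ?_⟩
  have hn0 : n ≠ 0 := by omega
  have hunit : ¬ IsUnit a := fun h => by
    rw [Int.isUnit_iff_abs_eq] at h
    omega
  have hirr := irreducible_X_pow_sub_C_of_squarefree hn0 ha hunit
  have : Fact (Irreducible ((X : ℚ[X]) ^ n - C (a : ℚ))) := ⟨hirr⟩
  have hmonic : ((X : ℚ[X]) ^ n - C (a : ℚ)).Monic := monic_X_pow_sub_C _ hn0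
  let B := AdjoinRoot.powerBasis hirr.ne_zero
  have hB : minpoly ℚ B.gen = X ^ n - C (a : ℚ) :=
    AdjoinRoot.minpoly_powerBasis_gen_of_monic hmonic
  have hK : NumberField (AdjoinRoot ((X : ℚ[X]) ^ n - C (a : ℚ))) :=
    { to_charZero := charZero_of_injective_algebraMap (algebraMap ℚ _).injective
      to_finiteDimensional := B.finite }
  refine ⟨hirr, hK, fun p hp hpn => ?_⟩
  have hdvd := NumberField.natAbs_discr_dvd_of_minpoly_eq_X_pow_sub_C B hn0 hB
  have hpa : Nat.Coprime p (a.natAbs ^ (n - 1)) :=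
    (Nat.Coprime.coprime_dvd_left hpn
      (Nat.Coprime.symm (Int.isCoprime_iff_gcd_eq_one.1 hcop))).pow_right _
  have hpow : p ^ padicValInt p (NumberField.discr (AdjoinRoot (X ^ n - C (a : ℚ)))) ∣ n ^ n :=
    (hpa.pow_left _).dvd_of_dvd_mul_right (pow_padicValNat_dvd.trans hdvd)
  exact (Nat.lt_pow_self hp.one_lt).le.trans (Nat.le_of_dvd (by positivity) hpow)
end
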